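/- Let α1, α2, α3 ∈ K and let n be a natural number. For every element p of the free associative algebra K⟨X_1,…,X_n⟩, if the image of p under every K-algebra homomorphism from K⟨X_1,…,X_n⟩ to M_6(K) × M_6(K) is zero, then the image of p under every K-algebra homomorphism from K⟨X_1,…,X_n⟩ to 𝒯(α1,α2,α3) is zero; i.e., every polynomial identity of M_6(K)² is a polynomial identity of 𝒯(α1,α2,α3). -/

import Mathlib

noncomputable section

open FreeAlgebra

/-- The defining relations of the algebra `𝒯(α₁, α₂)`: with generators `a = ι K 0`,
`b = ι K 1`, `c = ι K 2`, `d = ι K 3`, the relations are `a² = b² = c² = d² = α₁`,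
`ca + bc + ab = α₂`, `da + cd + ac = α₂`, `db + ba + ad = α₂`, `dc + cb + bd = α₂`. -/
inductive TRel (K : Type) [Field K] (α1 α2 : K) :
    FreeAlgebra K (Fin 4) → FreeAlgebra K (Fin 4) → Prop
  | ra : TRel K α1 α2 (ι K (0 : Fin 4) * ι K (0 : Fin 4))
      (algebraMap K (FreeAlgebra K (Fin 4)) α1)
  | rb : TRel K α1 α2 (ι K (1 : Fin 4) * ι K (1 : Fin 4))
      (algebraMap K (FreeAlgebra K (Fin 4)) α1)
  | rc : TRel K α1 α2 (ι K (2 : Fin 4) * ι K (2 : Fin 4))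
      (algebraMap K (FreeAlgebra K (Fin 4)) α1)
  | rd : TRel K α1 α2 (ι K (3 : Fin 4) * ι K (3 : Fin 4))
      (algebraMap K (FreeAlgebra K (Fin 4)) α1)
  | r1 : TRel K α1 α2
      (ι K (2 : Fin 4) * ι K (0 : Fin 4) + ι K (1 : Fin 4) * ι K (2 : Fin 4) +
        ι K (0 : Fin 4) * ι K (1 : Fin 4))
      (algebraMap K (FreeAlgebra K (Fin 4)) α2)
  | r2 : TRel K α1 α2
      (ι K (3 : Fin 4) * ι K (0 : Fin 4) + ι K (2 : Fin 4) * ι K (3 : Fin 4) +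
        ι K (0 : Fin 4) * ι K (2 : Fin 4))
      (algebraMap K (FreeAlgebra K (Fin 4)) α2)
  | r3 : TRel K α1 α2
      (ι K (3 : Fin 4) * ι K (1 : Fin 4) + ι K (1 : Fin 4) * ι K (0 : Fin 4) +
        ι K (0 : Fin 4) * ι K (3 : Fin 4))
      (algebraMap K (FreeAlgebra K (Fin 4)) α2)
  | r4 : TRel K α1 α2
      (ι K (3 : Fin 4) * ι K (2 : Fin 4) + ι K (2 : Fin 4) * ι K (1 : Fin 4) +
        ι K (1 : Fin 4) * ι K (3 : Fin 4))
      (algebraMap K (FreeAlgebra K (Fin 4)) α2)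

/-- The algebra `𝒯(α₁, α₂)`: the quotient of the free algebra `K⟨a,b,c,d⟩` by the
two-sided ideal generated by the relations above. -/
abbrev TAlg (K : Type) [Field K] (α1 α2 : K) : Type := RingQuot (TRel K α1 α2)

/-- The generator `a` of `𝒯(α₁, α₂)`. -/
def Ta (K : Type) [Field K] (α1 α2 : K) : TAlg K α1 α2 :=
  RingQuot.mkAlgHom K (TRel K α1 α2) (ι K (0 : Fin 4))

/-- The generator `b` of `𝒯(α₁, α₂)`. -/
def Tb (K : Type) [Field K] (α1 α2 : K) : TAlg K α1 α2 :=
  RingQuot.mkAlgHom K (TRel K α1 α2) (ι K (1 : Fin 4))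

/-- The generator `c` of `𝒯(α₁, α₂)`. -/
def Tc (K : Type) [Field K] (α1 α2 : K) : TAlg K α1 α2 :=
  RingQuot.mkAlgHom K (TRel K α1 α2) (ι K (2 : Fin 4))

/-- The generator `d` of `𝒯(α₁, α₂)`. -/
def Td (K : Type) [Field K] (α1 α2 : K) : TAlg K α1 α2 :=
  RingQuot.mkAlgHom K (TRel K α1 α2) (ι K (3 : Fin 4))

/-- The defining relations of the algebra `𝒯(α₁, α₂, α₃)`: those of `𝒯(α₁, α₂)`
together with `(cb + ba + ac - α₂)³ = α₃`. -/
inductive TRel3 (K : Type) [Field K] (α1 α2 α3 : K) :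
    FreeAlgebra K (Fin 4) → FreeAlgebra K (Fin 4) → Prop
  | base {x y : FreeAlgebra K (Fin 4)} : TRel K α1 α2 x y → TRel3 K α1 α2 α3 x y
  | r5 : TRel3 K α1 α2 α3
      ((ι K (2 : Fin 4) * ι K (1 : Fin 4) + ι K (1 : Fin 4) * ι K (0 : Fin 4) +
        ι K (0 : Fin 4) * ι K (2 : Fin 4) -
        algebraMap K (FreeAlgebra K (Fin 4)) α2) ^ 3)
      (algebraMap K (FreeAlgebra K (Fin 4)) α3)

/-- The algebra `𝒯(α₁, α₂, α₃)`. -/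
abbrev TAlg3 (K : Type) [Field K] (α1 α2 α3 : K) : Type := RingQuot (TRel3 K α1 α2 α3)

/-- The generator `a` of `𝒯(α₁, α₂, α₃)`. -/
def T3a (K : Type) [Field K] (α1 α2 α3 : K) : TAlg3 K α1 α2 α3 :=
  RingQuot.mkAlgHom K (TRel3 K α1 α2 α3) (ι K (0 : Fin 4))

/-- The generator `b` of `𝒯(α₁, α₂, α₃)`. -/
def T3b (K : Type) [Field K] (α1 α2 α3 : K) : TAlg3 K α1 α2 α3 :=
  RingQuot.mkAlgHom K (TRel3 K α1 α2 α3) (ι K (1 : Fin 4))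

/-- The generator `c` of `𝒯(α₁, α₂, α₃)`. -/
def T3c (K : Type) [Field K] (α1 α2 α3 : K) : TAlg3 K α1 α2 α3 :=
  RingQuot.mkAlgHom K (TRel3 K α1 α2 α3) (ι K (2 : Fin 4))

/-- The generator `d` of `𝒯(α₁, α₂, α₃)`. -/
def T3d (K : Type) [Field K] (α1 α2 α3 : K) : TAlg3 K α1 α2 α3 :=
  RingQuot.mkAlgHom K (TRel3 K α1 α2 α3) (ι K (3 : Fin 4))

/-- The element `y = ac + cb + ba - α₂` of `𝒯(α₁, α₂, α₃)`. -/
def T3y (K : Type) [Field K] (α1 α2 α3 : K) : TAlg3 K α1 α2 α3 :=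
  T3a K α1 α2 α3 * T3c K α1 α2 α3 + T3c K α1 α2 α3 * T3b K α1 α2 α3 +
    T3b K α1 α2 α3 * T3a K α1 α2 α3 - algebraMap K (TAlg3 K α1 α2 α3) α2

section PolynomialIdentities

/-- A polynomial identity of `m × m` matrices over an infinite field `K` is a polynomial identity
of `m × m` matrices over every commutative `K`-algebra. -/
theorem matrix_identity_of_infinite {K : Type*} [Field K] [Infinite K] {X m : Type*} [Fintype m]
    [DecidableEq m] {p : FreeAlgebra K X}
    (hp : ∀ f : FreeAlgebra K X →ₐ[K] Matrix m m K, f p = 0)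
    {Z : Type*} [CommRing Z] [Algebra K Z] (f : FreeAlgebra K X →ₐ[K] Matrix m m Z) : f p = 0 := by
  let generic : FreeAlgebra K X →ₐ[K] Matrix m m (MvPolynomial (X × m × m) K) :=
    FreeAlgebra.lift K fun k => Matrix.of fun i j => MvPolynomial.X (k, i, j)
  have hgen : generic p = 0 := by
    ext1 i j
    refine MvPolynomial.funext fun x => ?_
    have h := congrFun (congrFun (hp ((MvPolynomial.aeval x).mapMatrix.comp generic)) i) j
    simpa [MvPolynomial.aeval_def, MvPolynomial.eval₂_eq_eval_map] using h
  have hf : f = (MvPolynomial.aeval fun x : X × m × m => f (ι K x.1) x.2.1 x.2.2).mapMatrix.comp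
      generic := by
    ext k i j
    simp [generic]
  rw [hf, AlgHom.comp_apply, hgen, map_zero]

/-- If vectors `e j` generate `ι → F` as a module over `F[J]`, then every representation by matrices
commuting with `J` satisfies the identities of matrices indexed by `m`. -/
theorem identity_of_commute {K : Type*} [Field K] [Infinite K] {X m ι : Type*} [Fintype m]
    [DecidableEq m] [Fintype ι] [DecidableEq ι] {p : FreeAlgebra K X}
    (hp : ∀ f : FreeAlgebra K X →ₐ[K] Matrix m m K, f p = 0)
    {F : Type*} [CommRing F] [Algebra K F] (J : Matrix ι ι F) (e : m → ι → F)
    (he : ∀ v, ∃ z : m → Polynomial F, v = ∑ i, (Polynomial.aeval J (z i)).mulVec (e i))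
    (f : FreeAlgebra K X →ₐ[K] Matrix ι ι F) (hf : ∀ x, Commute (f x) J) : f p = 0 := by
  choose A hA using fun (k : X) (j : m) => he ((f (FreeAlgebra.ι K k)).mulVec (e j))
  let g : FreeAlgebra K X →ₐ[K] Matrix m m (Polynomial F) :=
    FreeAlgebra.lift K fun k => Matrix.of fun i j => A k j i
  have hcomm (x : FreeAlgebra K X) (z : Polynomial F) : Commute (f x) (Polynomial.aeval J z) := by
    induction z using Polynomial.induction_on' with
    | add a b ha hb => simpa using ha.add_right hb
    | monomial n a =>
      rw [Polynomial.aeval_monomial]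
      exact (Algebra.commute_algebraMap_right a (f x)).mul_right ((hf x).pow_right n)
  have key (x : FreeAlgebra K X) : ∀ j,
      (f x).mulVec (e j) = ∑ i, (Polynomial.aeval J (g x i j)).mulVec (e i) := by
    induction x with
    | grade0 r =>
      intro j
      rw [Finset.sum_eq_single j]
      · simp [Matrix.algebraMap_matrix_apply, IsScalarTower.algebraMap_apply K F (Polynomial F),
          Polynomial.algebraMap_eq]
        simp [← IsScalarTower.algebraMap_apply]
      · intro i _ hij
        simp [Matrix.algebraMap_matrix_apply, hij]
      · simp
    | grade1 k =>
      intro j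
      simpa [g] using hA k j
    | mul x y hx hy =>
      intro j
      simp only [map_mul, ← Matrix.mulVec_mulVec, hy, Matrix.mul_apply, map_sum, Matrix.sum_mulVec,
        Matrix.mulVec_sum]
      rw [Finset.sum_comm]
      refine Finset.sum_congr rfl fun l _ => ?_
      rw [Matrix.mulVec_mulVec, (hcomm x _).eq, ← Matrix.mulVec_mulVec, hx, Matrix.mulVec_sum]
      refine Finset.sum_congr rfl fun i _ => ?_
      rw [Matrix.mulVec_mulVec, Matrix.mulVec_mulVec, ← map_mul, ← map_mul, mul_comm (g y l j)]
    | add x y hx hy =>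
      intro j
      simp [Matrix.add_mulVec, hx, hy, Finset.sum_add_distrib]
  have hzero (j : m) : (f p).mulVec (e j) = 0 := by
    simp [key, matrix_identity_of_infinite hp g]
  refine Matrix.mulVec_injective (funext fun v => ?_)
  obtain ⟨z, rfl⟩ := he v
  rw [Matrix.zero_mulVec, Matrix.mulVec_sum]
  refine Finset.sum_eq_zero fun i _ => ?_
  rw [Matrix.mulVec_mulVec, (hcomm p _).eq, ← Matrix.mulVec_mulVec, hzero, Matrix.mulVec_zero]

end PolynomialIdentities

section TwistedMatrices

variable {R : Type*} [CommRing R]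

/-- Left multiplication by `a` on the subalgebra of `𝒯(p, q)` generated by `a`, `b`, `c`, in the basis
`1, a, b, ab, ba, aba` over the polynomials in `S = a + b + c`. -/
def leftA (p : R) : Matrix (Fin 6) (Fin 6) R
  | 0, 0 => 0
  | 0, 1 => p
  | 0, 2 => 0
  | 0, 3 => 0
  | 0, 4 => 0
  | 0, 5 => 0
  | 1, 0 => 1
  | 1, 1 => 0
  | 1, 2 => 0
  | 1, 3 => 0
  | 1, 4 => 0
  | 1, 5 => 0
  | 2, 0 => 0
  | 2, 1 => 0
  | 2, 2 => 0
  | 2, 3 => p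
  | 2, 4 => 0
  | 2, 5 => 0
  | 3, 0 => 0
  | 3, 1 => 0
  | 3, 2 => 1
  | 3, 3 => 0
  | 3, 4 => 0
  | 3, 5 => 0
  | 4, 0 => 0
  | 4, 1 => 0
  | 4, 2 => 0
  | 4, 3 => 0
  | 4, 4 => 0
  | 4, 5 => p
  | 5, 0 => 0
  | 5, 1 => 0
  | 5, 2 => 0
  | 5, 3 => 0
  | 5, 4 => 1
  | 5, 5 => 0

/-- Left multiplication by `b` in the basis of `leftA`. -/
def leftB (p q : R) : Matrix (Fin 6) (Fin 6) R
  | 0, 0 => 0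
  | 0, 1 => 0
  | 0, 2 => p
  | 0, 3 => 0
  | 0, 4 => 0
  | 0, 5 => -p * q
  | 1, 0 => 0
  | 1, 1 => 0
  | 1, 2 => 0
  | 1, 3 => -q
  | 1, 4 => p
  | 1, 5 => 0
  | 2, 0 => 1
  | 2, 1 => 0
  | 2, 2 => 0
  | 2, 3 => q
  | 2, 4 => 0
  | 2, 5 => 0
  | 3, 0 => 0
  | 3, 1 => 0
  | 3, 2 => 0
  | 3, 3 => 0
  | 3, 4 => 0
  | 3, 5 => p
  | 4, 0 => 0
  | 4, 1 => 1
  | 4, 2 => 0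
  | 4, 3 => 0
  | 4, 4 => 0
  | 4, 5 => q
  | 5, 0 => 0
  | 5, 1 => 0
  | 5, 2 => 0
  | 5, 3 => 1
  | 5, 4 => 0
  | 5, 5 => 0

/-- Left multiplication by `c` in the basis of `leftA`. -/
def leftC (p q S : R) : Matrix (Fin 6) (Fin 6) R
  | 0, 0 => S
  | 0, 1 => q + p
  | 0, 2 => S ^ 2 - q - 2 * p
  | 0, 3 => 0
  | 0, 4 => S ^ 3 - 2 * q * S - 3 * p * S
  | 0, 5 => p * S ^ 2 - 3 * p * q - 4 * p ^ 2
  | 1, 0 => -1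
  | 1, 1 => 0
  | 1, 2 => -S
  | 1, 3 => q
  | 1, 4 => -S ^ 2 + 2 * q + 2 * p
  | 1, 5 => q * S
  | 2, 0 => -1
  | 2, 1 => -S
  | 2, 2 => 0
  | 2, 3 => -S ^ 2 + q + 2 * p
  | 2, 4 => -S ^ 2 + 2 * q + 3 * p
  | 2, 5 => -S ^ 3 + q * S + 3 * p * S
  | 3, 0 => 0
  | 3, 1 => -1
  | 3, 2 => 1
  | 3, 3 => 0
  | 3, 4 => S
  | 3, 5 => p
  | 4, 0 => 0
  | 4, 1 => 1
  | 4, 2 => -1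
  | 4, 3 => S
  | 4, 4 => 0
  | 4, 5 => S ^ 2 - 2 * p
  | 5, 0 => 0
  | 5, 1 => 0
  | 5, 2 => 0
  | 5, 3 => -1
  | 5, 4 => -1
  | 5, 5 => -S

set_option maxHeartbeats 1000000 in
/-- The component in the subalgebra generated by `a`, `b`, `c` of the operator `twist`. -/
def twistEven (p q S : R) : Matrix (Fin 6) (Fin 6) R
  | 0, 0 => 0
  | 0, 1 => q ^ 3 - 2 * p * q * S ^ 2 + 4 * p * q ^ 2 + 2 * p ^ 2 * S ^ 2 + 3 * p ^ 2 * q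
  | 0, 2 => -q ^ 2 * S ^ 2 + 2 * q ^ 3 + p * S ^ 4 - 4 * p * q * S ^ 2 + 10 * p * q ^ 2 -
      7 * p ^ 2 * S ^ 2 + 18 * p ^ 2 * q + 9 * p ^ 3
  | 0, 3 => q ^ 3 * S - p * q * S ^ 3 - p * q ^ 2 * S + p ^ 2 * S ^ 3 + 4 * p ^ 2 * q * S
  | 0, 4 => -p * q * S ^ 3 + 3 * p * q ^ 2 * S + p ^ 2 * S ^ 3 + 3 * p ^ 2 * q * S - 6 * p ^ 3 * S
  | 0, 5 => q ^ 3 * S ^ 2 - q ^ 4 - 3 * p * q * S ^ 4 + 9 * p * q ^ 2 * S ^ 2 - 11 * p * q ^ 3 +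
      21 * p ^ 2 * q * S ^ 2 - 33 * p ^ 2 * q ^ 2 + 5 * p ^ 3 * S ^ 2 - 42 * p ^ 3 * q - 18 * p ^ 4
  | 1, 0 => 2 * q * S ^ 2 - 8 * q ^ 2 - 6 * p * q
  | 1, 1 => 2 * q * S ^ 3 - 6 * q ^ 2 * S - 6 * p * q * S - 6 * p ^ 2 * S
  | 1, 2 => q * S ^ 3 - 3 * q ^ 2 * S + p * S ^ 3 - 7 * p * q * S
  | 1, 3 => 2 * q * S ^ 4 - 7 * q ^ 2 * S ^ 2 + 4 * q ^ 3 + p * S ^ 4 - 18 * p * q * S ^ 2 +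
      34 * p * q ^ 2 - 9 * p ^ 2 * S ^ 2 + 36 * p ^ 2 * q + 9 * p ^ 3
  | 1, 4 => q * S ^ 4 - 5 * q ^ 2 * S ^ 2 + 4 * q ^ 3 - 4 * p * q * S ^ 2 + 13 * p * q ^ 2 +
      3 * p ^ 2 * S ^ 2 - 3 * p ^ 2 * q - 9 * p ^ 3
  | 1, 5 => 2 * q * S ^ 5 - 8 * q ^ 2 * S ^ 3 + 7 * q ^ 3 * S - 13 * p * q * S ^ 3 +
      29 * p * q ^ 2 * S - p ^ 2 * S ^ 3 + 20 * p ^ 2 * q * S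
  | 2, 0 => -S ^ 4 + 5 * q * S ^ 2 - 4 * q ^ 2 + 6 * p * S ^ 2 - 15 * p * q - 9 * p ^ 2
  | 2, 1 => p * S ^ 3 - 3 * p ^ 2 * S
  | 2, 2 => -2 * S ^ 5 + 9 * q * S ^ 3 - 10 * q ^ 2 * S + 12 * p * S ^ 3 - 29 * p * q * S -
      18 * p ^ 2 * S
  | 2, 3 => 2 * p * q * S ^ 2 - 2 * p * q ^ 2 + 3 * p ^ 2 * S ^ 2 - 12 * p ^ 2 * q - 9 * p ^ 3
  | 2, 4 => -q * S ^ 4 + 5 * q ^ 2 * S ^ 2 - 4 * q ^ 3 - 2 * p * S ^ 4 + 12 * p * q * S ^ 2 -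
      24 * p * q ^ 2 + 12 * p ^ 2 * S ^ 2 - 27 * p ^ 2 * q - 9 * p ^ 3
  | 2, 5 => 2 * p * q * S ^ 3 - 3 * p * q ^ 2 * S - p ^ 2 * S ^ 3 - 6 * p ^ 2 * q * S +
      6 * p ^ 3 * S
  | 3, 0 => S ^ 3 - 4 * q * S - 3 * p * S
  | 3, 1 => -S ^ 4 + 3 * q * S ^ 2 - 4 * q ^ 2 + 8 * p * S ^ 2 - 15 * p * q - 9 * p ^ 2
  | 3, 2 => -q ^ 2 - p * S ^ 2
  | 3, 3 => -2 * S ^ 5 + 9 * q * S ^ 3 - 12 * q ^ 2 * S + 14 * p * S ^ 3 - 31 * p * q * S -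
      24 * p ^ 2 * S
  | 3, 4 => -p * S ^ 3 + 3 * p ^ 2 * S
  | 3, 5 => -q * S ^ 4 + 3 * q ^ 2 * S ^ 2 - 3 * q ^ 3 + 6 * p * q * S ^ 2 - 11 * p * q ^ 2 +
      2 * p ^ 2 * S ^ 2 - 6 * p ^ 2 * q
  | 4, 0 => S ^ 3 - 4 * q * S - 3 * p * S
  | 4, 1 => -q ^ 2 - p * S ^ 2
  | 4, 2 => 2 * S ^ 4 - 7 * q * S ^ 2 + 5 * q ^ 2 - 10 * p * S ^ 2 + 15 * p * q + 9 * p ^ 2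
  | 4, 3 => -q ^ 2 * S - p * S ^ 3 + 4 * p * q * S
  | 4, 4 => q * S ^ 3 - 4 * q ^ 2 * S + 2 * p * S ^ 3 - 5 * p * q * S - 12 * p ^ 2 * S
  | 4, 5 => -q ^ 2 * S ^ 2 + q ^ 3 + p * S ^ 4 - 5 * p * q * S ^ 2 + 10 * p * q ^ 2 -
      7 * p ^ 2 * S ^ 2 + 18 * p ^ 2 * q + 9 * p ^ 3
  | 5, 0 => -3 * S ^ 2 + 12 * q + 9 * p
  | 5, 1 => -S ^ 3 + 4 * q * S + 3 * p * S
  | 5, 2 => -S ^ 3 + 4 * q * S + 3 * p * S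
  | 5, 3 => -q * S ^ 2 + 4 * q ^ 2 + 3 * p * q
  | 5, 4 => -S ^ 4 + 5 * q * S ^ 2 - 4 * q ^ 2 + 6 * p * S ^ 2 - 15 * p * q - 9 * p ^ 2
  | 5, 5 => -2 * S ^ 5 + 9 * q * S ^ 3 - 10 * q ^ 2 * S + 14 * p * S ^ 3 - 31 * p * q * S -
      30 * p ^ 2 * S

set_option maxHeartbeats 1000000 in
/-- The component along `d` of the operator `twist`. -/
def twistOdd (p q S : R) : Matrix (Fin 6) (Fin 6) R
  | 0, 0 => q ^ 2 - 2 * p * S ^ 2 + 12 * p * q + 9 * p ^ 2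
  | 0, 1 => -2 * p * S ^ 3 + 8 * p * q * S + 6 * p ^ 2 * S
  | 0, 2 => q ^ 2 * S + 3 * p ^ 2 * S
  | 0, 3 => -2 * p * S ^ 4 + 6 * p * q * S ^ 2 - p * q ^ 2 + 10 * p ^ 2 * S ^ 2 - 12 * p ^ 2 * q -
      9 * p ^ 3
  | 0, 4 => q ^ 2 * S ^ 2 - q ^ 3 - 2 * p * S ^ 4 + 10 * p * q * S ^ 2 - 14 * p * q ^ 2 +
      13 * p ^ 2 * S ^ 2 - 33 * p ^ 2 * q - 18 * p ^ 3
  | 0, 5 => -2 * p * S ^ 5 + 8 * p * q * S ^ 3 - 6 * p * q ^ 2 * S + 12 * p ^ 2 * S ^ 3 -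
      26 * p ^ 2 * q * S - 18 * p ^ 3 * S
  | 1, 0 => -4 * q * S
  | 1, 1 => -2 * q * S ^ 2 + 2 * p * S ^ 2
  | 1, 2 => -2 * q * S ^ 2 + q ^ 2 - 4 * p * S ^ 2 + 12 * p * q + 9 * p ^ 2
  | 1, 3 => -2 * q ^ 2 * S + 2 * p * S ^ 3 - 2 * p * q * S - 6 * p ^ 2 * S
  | 1, 4 => -2 * q * S ^ 3 + 3 * q ^ 2 * S + 6 * p * q * S - 3 * p ^ 2 * S
  | 1, 5 => -2 * q ^ 2 * S ^ 2 + q ^ 3 + 2 * p * S ^ 4 - 6 * p * q * S ^ 2 + 13 * p * q ^ 2 -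
      10 * p ^ 2 * S ^ 2 + 21 * p ^ 2 * q + 9 * p ^ 3
  | 2, 0 => 2 * S ^ 3 - 2 * q * S - 6 * p * S
  | 2, 1 => 2 * q * S ^ 2 - q ^ 2 + 2 * p * S ^ 2 - 12 * p * q - 9 * p ^ 2
  | 2, 2 => 2 * S ^ 4 - 4 * q * S ^ 2 + q ^ 2 - 10 * p * S ^ 2 + 12 * p * q + 9 * p ^ 2
  | 2, 3 => q ^ 2 * S - 3 * p ^ 2 * S
  | 2, 4 => 2 * S ^ 5 - 6 * q * S ^ 3 + 4 * q ^ 2 * S - 12 * p * S ^ 3 + 20 * p * q * S +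
      18 * p ^ 2 * S
  | 2, 5 => q ^ 2 * S ^ 2 + 2 * p * S ^ 4 - 8 * p * q * S ^ 2 + 2 * p * q ^ 2 -
      13 * p ^ 2 * S ^ 2 + 24 * p ^ 2 * q + 18 * p ^ 3
  | 3, 0 => -2 * S ^ 2
  | 3, 1 => -6 * p * S
  | 3, 2 => -2 * q * S
  | 3, 3 => -2 * p * S ^ 2
  | 3, 4 => -2 * q * S ^ 2 + q ^ 2 - 2 * p * S ^ 2 + 12 * p * q + 9 * p ^ 2
  | 3, 5 => -2 * p * S ^ 3 + 2 * p * q * S + 6 * p ^ 2 * S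
  | 4, 0 => -2 * S ^ 2
  | 4, 1 => -2 * q * S
  | 4, 2 => -2 * S ^ 3 + 2 * q * S + 6 * p * S
  | 4, 3 => -q ^ 2 + 4 * p * S ^ 2 - 12 * p * q - 9 * p ^ 2
  | 4, 4 => -2 * S ^ 4 + 4 * q * S ^ 2 - q ^ 2 + 10 * p * S ^ 2 - 12 * p * q - 9 * p ^ 2
  | 4, 5 => -q ^ 2 * S + 3 * p ^ 2 * S
  | 5, 0 => 6 * S
  | 5, 1 => 2 * S ^ 2
  | 5, 2 => 2 * S ^ 2
  | 5, 3 => 2 * q * S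
  | 5, 4 => 2 * S ^ 3 - 2 * q * S - 6 * p * S
  | 5, 5 => 2 * q * S ^ 2 - q ^ 2 + 2 * p * S ^ 2 - 12 * p * q - 9 * p ^ 2

/-- The scalar by which the square of `twistOdd` acts on the first basis vector. -/
def twistNorm (p q S : R) : R :=
  q ^ 4 - 4 * p * S ^ 6 + 24 * p * q * S ^ 4 - 48 * p * q ^ 2 * S ^ 2 + 24 * p * q ^ 3 +
    36 * p ^ 2 * S ^ 4 - 144 * p ^ 2 * q * S ^ 2 + 162 * p ^ 2 * q ^ 2 - 108 * p ^ 3 * S ^ 2 +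
    216 * p ^ 3 * q + 81 * p ^ 4

theorem twistOdd_mul_leftA (p q S : R) :
    twistOdd p q S * leftA p = -(leftB p q * twistOdd p q S) := by
  ext i j
  simp only [Matrix.neg_apply, Matrix.mul_apply, Fin.sum_univ_six]
  fin_cases i <;> fin_cases j <;> simp only [twistOdd, leftA, leftB] <;> ring

theorem twistOdd_mul_leftB (p q S : R) :
    twistOdd p q S * leftB p q = -(leftC p q S * twistOdd p q S) := by
  ext i j
  simp only [Matrix.neg_apply, Matrix.mul_apply, Fin.sum_univ_six]
  fin_cases i <;> fin_cases j <;> simp only [twistOdd, leftB, leftC] <;> ring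

theorem twistOdd_mul_leftC (p q S : R) :
    twistOdd p q S * leftC p q S = -(leftA p * twistOdd p q S) := by
  ext i j
  simp only [Matrix.neg_apply, Matrix.mul_apply, Fin.sum_univ_six]
  fin_cases i <;> fin_cases j <;> simp only [twistOdd, leftA, leftC] <;> ring

theorem twistEven_mul_leftA (p q S : R) :
    twistEven p q S * leftA p =
      leftA p * twistEven p q S + (q • 1 - leftB p q * leftA p) * twistOdd p q S := by
  rw [sub_mul, smul_mul_assoc, one_mul]
  ext i j
  simp only [Matrix.add_apply, Matrix.sub_apply, Matrix.smul_apply, smul_eq_mul, Matrix.mul_apply,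
    Fin.sum_univ_six]
  fin_cases i <;> fin_cases j <;>
    simp only [twistEven, twistOdd, leftA, leftB] <;> ring

theorem twistEven_mul_leftB (p q S : R) :
    twistEven p q S * leftB p q =
      leftB p q * twistEven p q S + (q • 1 - leftC p q S * leftB p q) * twistOdd p q S := by
  rw [sub_mul, smul_mul_assoc, one_mul]
  ext i j
  simp only [Matrix.add_apply, Matrix.sub_apply, Matrix.smul_apply, smul_eq_mul, Matrix.mul_apply,
    Fin.sum_univ_six]
  fin_cases i <;> fin_cases j <;>
    simp only [twistEven, twistOdd, leftB, leftC] <;> ring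

theorem twistEven_mul_leftC (p q S : R) :
    twistEven p q S * leftC p q S =
      leftC p q S * twistEven p q S + (q • 1 - leftA p * leftC p q S) * twistOdd p q S := by
  rw [sub_mul, smul_mul_assoc, one_mul]
  ext i j
  simp only [Matrix.add_apply, Matrix.sub_apply, Matrix.smul_apply, smul_eq_mul, Matrix.mul_apply,
    Fin.sum_univ_six]
  fin_cases i <;> fin_cases j <;>
    simp only [twistEven, twistOdd, leftA, leftC] <;> ring

theorem leftA_mul_self (p : R) : leftA p * leftA p = p • 1 := by
  ext i j
  simp only [Matrix.smul_apply, Matrix.mul_apply, Fin.sum_univ_six]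
  fin_cases i <;> fin_cases j <;> simp [leftA]

theorem leftB_mul_self (p q : R) : leftB p q * leftB p q = p • 1 := by
  ext i j
  simp only [Matrix.smul_apply, Matrix.mul_apply, Fin.sum_univ_six]
  fin_cases i <;> fin_cases j <;> simp [leftB] <;> ring

theorem leftC_mul_self (p q S : R) : leftC p q S * leftC p q S = p • 1 := by
  ext i j
  simp only [Matrix.smul_apply, Matrix.mul_apply, Fin.sum_univ_six]
  fin_cases i <;> fin_cases j <;> simp [leftC] <;> ring

theorem twistOdd_sq_mulVec (p q S : R) :
    (twistOdd p q S * twistOdd p q S).mulVec (Pi.single 0 1) = Pi.single 0 (twistNorm p q S) := by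
  ext i
  simp only [Matrix.mulVec_single_one, Matrix.col_apply, Matrix.mul_apply, Fin.sum_univ_six]
  fin_cases i <;> simp [twistOdd, twistNorm] <;> ring

end TwistedMatrices

section TwistedBlocks

variable {R : Type*} [CommRing R]

/-- The block matrix of left multiplication by an element `x` with `x d = q - d y - y x`, where `X`
and `Y` are the matrices of left multiplication by `x` and `y`. -/
def blockOf (q : R) (X Y : Matrix (Fin 6) (Fin 6) R) : Matrix (Fin 6 ⊕ Fin 6) (Fin 6 ⊕ Fin 6) R :=
  Matrix.fromBlocks X (q • 1 - Y * X) 0 (-Y)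

/-- The block matrix of left multiplication by an element `d` with `d ^ 2 = p`. -/
def blockD (p : R) : Matrix (Fin 6 ⊕ Fin 6) (Fin 6 ⊕ Fin 6) R :=
  Matrix.fromBlocks 0 (p • 1) 1 0

/-- A matrix commuting with left multiplication by the generators of `𝒯(p, q)`. -/
def twist (p q S : R) : Matrix (Fin 6 ⊕ Fin 6) (Fin 6 ⊕ Fin 6) R :=
  Matrix.fromBlocks (twistEven p q S) (p • twistOdd p q S) (twistOdd p q S) (twistEven p q S)

theorem commute_blockD_twist (p q S : R) : Commute (blockD p) (twist p q S) := by
  simp [Commute, SemiconjBy, blockD, twist, Matrix.fromBlocks_multiply]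

theorem commute_blockOf_fromBlocks {p q : R} {X Y W P Q : Matrix (Fin 6) (Fin 6) R}
    (hQX : Q * X = -(Y * Q)) (hQY : Q * Y = -(W * Q))
    (hPX : P * X = X * P + (q • 1 - Y * X) * Q) (hPY : P * Y = Y * P + (q • 1 - W * Y) * Q)
    (hYY : Y * Y = p • 1) :
    Commute (blockOf q X Y) (Matrix.fromBlocks P (p • Q) Q P) := by
  simp only [Commute, SemiconjBy, blockOf, Matrix.fromBlocks_multiply]
  congr 1
  · rw [hPX, mul_zero, add_zero]
  · have h : P * (Y * X) = Y * (X * P) - p • (X * Q) + p • (W * Q) := by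
      have hY (M : Matrix (Fin 6) (Fin 6) R) : Y * (Y * M) = p • M := by
        rw [← mul_assoc, hYY, smul_mul_assoc, one_mul]
      rw [← mul_assoc, hPY, add_mul, mul_assoc, hPX, mul_assoc, hQX]
      simp only [mul_add, sub_mul, mul_sub, mul_neg, smul_mul_assoc, mul_smul_comm, one_mul,
        mul_assoc, hY]
      abel
    simp only [sub_mul, mul_sub, mul_neg, smul_mul_assoc, mul_smul_comm, one_mul, mul_one,
      mul_assoc, h, hQY, smul_neg]
    abel
  · simp [hQX]
  · have h : Q * (Y * X) = W * (Y * Q) := by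
      rw [← mul_assoc, hQY, neg_mul, mul_assoc, hQX, mul_neg, neg_neg]
    simp only [zero_mul, smul_zero, zero_add, mul_neg, neg_mul, hPY, sub_mul, mul_sub, smul_mul_assoc, mul_smul_comm,
      one_mul, mul_one, mul_assoc, h]
    abel

theorem commute_blockOf_leftA (p q S : R) :
    Commute (blockOf q (leftA p) (leftB p q)) (twist p q S) :=
  commute_blockOf_fromBlocks (twistOdd_mul_leftA p q S) (twistOdd_mul_leftB p q S)
    (twistEven_mul_leftA p q S) (twistEven_mul_leftB p q S) (leftB_mul_self p q)

theorem commute_blockOf_leftB (p q S : R) :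
    Commute (blockOf q (leftB p q) (leftC p q S)) (twist p q S) :=
  commute_blockOf_fromBlocks (twistOdd_mul_leftB p q S) (twistOdd_mul_leftC p q S)
    (twistEven_mul_leftB p q S) (twistEven_mul_leftC p q S) (leftC_mul_self p q S)

theorem commute_blockOf_leftC (p q S : R) :
    Commute (blockOf q (leftC p q S) (leftA p)) (twist p q S) :=
  commute_blockOf_fromBlocks (twistOdd_mul_leftC p q S) (twistOdd_mul_leftA p q S)
    (twistEven_mul_leftC p q S) (twistEven_mul_leftA p q S) (leftA_mul_self p)

theorem commute_twistOdd_pow_left (p q S : R) :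
    Commute (twistOdd p q S ^ 6) (leftA p) ∧ Commute (twistOdd p q S ^ 6) (leftB p q) := by
  have hA : SemiconjBy (twistOdd p q S) (leftA p) (-leftB p q) := by
    rw [SemiconjBy, twistOdd_mul_leftA, neg_mul]
  have hB : SemiconjBy (twistOdd p q S) (leftB p q) (-leftC p q S) := by
    rw [SemiconjBy, twistOdd_mul_leftB, neg_mul]
  have hC : SemiconjBy (twistOdd p q S) (leftC p q S) (-leftA p) := by
    rw [SemiconjBy, twistOdd_mul_leftC, neg_mul]
  have hA3 := hC.neg_right.neg_right.mul_left (hB.neg_right.mul_left hA)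
  have hB3 := hA.neg_right.neg_right.mul_left (hC.neg_right.mul_left hB)
  have h6 : twistOdd p q S ^ 6 = twistOdd p q S * (twistOdd p q S * twistOdd p q S) *
      (twistOdd p q S * (twistOdd p q S * twistOdd p q S)) := by
    simp only [pow_succ, pow_zero, one_mul, mul_assoc]
  rw [h6]
  simp only [neg_neg] at hA3 hB3
  have hA6 := hA3.neg_right.mul_left hA3
  have hB6 := hB3.neg_right.mul_left hB3
  simp only [neg_neg] at hA6 hB6
  exact ⟨hA6, hB6⟩

theorem twistOdd_pow_six (p q S : R) : twistOdd p q S ^ 6 = twistNorm p q S ^ 3 • 1 := by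
  obtain ⟨hA, hB⟩ := commute_twistOdd_pow_left p q S
  have h0 : (twistOdd p q S ^ 6).mulVec (Pi.single 0 1) =
      twistNorm p q S ^ 3 • Pi.single 0 1 := by
    have h : (twistOdd p q S * twistOdd p q S).mulVec (Pi.single 0 1) =
        twistNorm p q S • Pi.single 0 1 := by
      rw [twistOdd_sq_mulVec, ← Pi.single_smul, smul_eq_mul, mul_one]
    rw [show twistOdd p q S ^ 6 = twistOdd p q S * twistOdd p q S *
      (twistOdd p q S * twistOdd p q S * (twistOdd p q S * twistOdd p q S)) by
        simp only [pow_succ, pow_zero, one_mul, mul_assoc]]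
    simp only [← Matrix.mulVec_mulVec _ (twistOdd p q S * twistOdd p q S), h, Matrix.mulVec_smul,
      smul_smul]
    ring_nf
  have step {M : Matrix (Fin 6) (Fin 6) R} (hM : Commute (twistOdd p q S ^ 6) M) {v : Fin 6 → R}
      (hv : (twistOdd p q S ^ 6).mulVec v = twistNorm p q S ^ 3 • v) :
      (twistOdd p q S ^ 6).mulVec (M.mulVec v) = twistNorm p q S ^ 3 • M.mulVec v := by
    rw [Matrix.mulVec_mulVec, hM.eq, ← Matrix.mulVec_mulVec, hv, Matrix.mulVec_smul]
  have e1 : (leftA p).mulVec (Pi.single 0 1) = Pi.single 1 1 := by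
    ext i; fin_cases i <;> simp [leftA]
  have e2 : (leftB p q).mulVec (Pi.single 0 1) = Pi.single 2 1 := by
    ext i; fin_cases i <;> simp [leftB]
  have e3 : (leftA p).mulVec (Pi.single 2 1) = Pi.single 3 1 := by
    ext i; fin_cases i <;> simp [leftA]
  have e4 : (leftB p q).mulVec (Pi.single 1 1) = Pi.single 4 1 := by
    ext i; fin_cases i <;> simp [leftB]
  have e5 : (leftA p).mulVec (Pi.single 4 1) = Pi.single 5 1 := by
    ext i; fin_cases i <;> simp [leftA]
  have h1 := e1 ▸ step hA h0
  have h2 := e2 ▸ step hB h0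
  have h3 := e3 ▸ step hA h2
  have h4 := e4 ▸ step hB h1
  have h5 := e5 ▸ step hA h4
  refine Matrix.ext_of_mulVec_single fun i => ?_
  rw [Matrix.smul_mulVec, Matrix.one_mulVec]
  fin_cases i
  exacts [h0, h1, h2, h3, h4, h5]

theorem exists_aeval_twist {F : Type*} [Field F] {p q S : F} (h : twistNorm p q S ≠ 0)
    (v : Fin 6 ⊕ Fin 6 → F) : ∃ z : Fin 6 → Polynomial F,
      v = ∑ i, (Polynomial.aeval (twist p q S) (z i)).mulVec (Pi.single (Sum.inl i) 1) := by
  set y : Fin 6 → F := (twistNorm p q S ^ 3)⁻¹ • (twistOdd p q S ^ 5).mulVec (v ∘ Sum.inr) with hy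
  set x : Fin 6 → F := v ∘ Sum.inl - (twistEven p q S).mulVec y with hx
  have hQy : (twistOdd p q S).mulVec y = v ∘ Sum.inr := by
    rw [hy, Matrix.mulVec_smul, Matrix.mulVec_mulVec, ← pow_succ', twistOdd_pow_six,
      Matrix.smul_mulVec, Matrix.one_mulVec, inv_smul_smul₀ (pow_ne_zero 3 h)]
  have hsum (w : Fin 6 → F) :
      ∑ i, w i • (Pi.single (Sum.inl i) 1 : Fin 6 ⊕ Fin 6 → F) = Sum.elim w 0 := by
    ext (j | j) <;> simp [Finset.sum_apply, Pi.single_apply]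
  refine ⟨fun i => Polynomial.C (x i) + Polynomial.C (y i) * Polynomial.X, ?_⟩
  have hz : ∑ i, (Polynomial.aeval (twist p q S)
      (Polynomial.C (x i) + Polynomial.C (y i) * Polynomial.X)).mulVec (Pi.single (Sum.inl i) 1) =
      Sum.elim x 0 + (twist p q S).mulVec (Sum.elim y 0) := by
    rw [← hsum x, ← hsum y, Matrix.mulVec_sum, ← Finset.sum_add_distrib]
    refine Finset.sum_congr rfl fun i _ => ?_
    rw [map_add, map_mul, Polynomial.aeval_C, Polynomial.aeval_C, Polynomial.aeval_X,
      Matrix.add_mulVec, Algebra.algebraMap_eq_smul_one, Algebra.algebraMap_eq_smul_one,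
      smul_mul_assoc, one_mul, Matrix.smul_mulVec, Matrix.smul_mulVec, Matrix.one_mulVec,
      Matrix.mulVec_smul]
  rw [hz, twist, Matrix.fromBlocks_mulVec]
  ext (j | j)
  · simp [hx]
  · simpa using (congrFun hQy j).symm

theorem map_twistNorm {R' : Type*} [CommRing R'] (f : R →+* R') (p q S : R) :
    f (twistNorm p q S) = twistNorm (f p) (f q) (f S) := by
  simp [twistNorm, map_ofNat]

theorem map_twistEven {R' : Type*} [CommRing R'] (f : R →+* R') (p q S : R) :
    (twistEven p q S).map f = twistEven (f p) (f q) (f S) := by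
  ext i j
  fin_cases i <;> fin_cases j <;> simp [twistEven, map_ofNat]

theorem map_twistOdd {R' : Type*} [CommRing R'] (f : R →+* R') (p q S : R) :
    (twistOdd p q S).map f = twistOdd (f p) (f q) (f S) := by
  ext i j
  fin_cases i <;> fin_cases j <;> simp [twistOdd, map_ofNat]

theorem map_twist {R' : Type*} [CommRing R'] (f : R →+* R') (p q S : R) :
    (twist p q S).map f = twist (f p) (f q) (f S) := by
  rw [twist, Matrix.fromBlocks_map, Matrix.map_smul' f _ _ (map_mul f), map_twistEven, map_twistOdd, twist]

theorem identity_of_commute_twist {K : Type*} [Field K] [Infinite K] {X : Type*}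
    {f : FreeAlgebra K X}
    (hf : ∀ φ : FreeAlgebra K X →ₐ[K] Matrix (Fin 6) (Fin 6) K, φ f = 0)
    [IsDomain R] [Algebra K R] {p q S : R} (h : twistNorm p q S ≠ 0)
    (φ : FreeAlgebra K X →ₐ[K] Matrix (Fin 6 ⊕ Fin 6) (Fin 6 ⊕ Fin 6) R)
    (hφ : ∀ x, Commute (φ x) (twist p q S)) : φ f = 0 := by
  let i : R →ₐ[K] FractionRing R := IsScalarTower.toAlgHom K R (FractionRing R)
  have hi : Function.Injective i := IsFractionRing.injective R (FractionRing R)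
  have htwist : i.mapMatrix (twist p q S) = twist (i p) (i q) (i S) :=
    map_twist i.toRingHom p q S
  have hnorm : twistNorm (i p) (i q) (i S) = i (twistNorm p q S) :=
    (map_twistNorm i.toRingHom p q S).symm
  have hzero : (i.mapMatrix.comp φ) f = 0 :=
    identity_of_commute hf (twist (i p) (i q) (i S)) (fun j => Pi.single (Sum.inl j) 1)
      (exists_aeval_twist (by rwa [hnorm, map_ne_zero_iff i hi])) _
      fun x => htwist ▸ (hφ x).map i.mapMatrix
  exact (Matrix.map_injective hi) (by simpa using hzero)

end TwistedBlocks

section Intertwining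

variable {R T : Type*} [CommRing R] [Ring T]

/-- Right multiplication of the family `w` by the matrix `M` agrees with left multiplication
by `x`. -/
def Intertwines {ι : Type*} [Fintype ι] (φ : R →+* T) (w : ι → T) (M : Matrix ι ι R) (x : T) :
    Prop :=
  ∀ j, ∑ i, w i * φ (M i j) = x * w j

namespace Intertwines

variable {ι : Type*} [Fintype ι] {φ : R →+* T} {w : ι → T} {M N : Matrix ι ι R} {x y : T}

theorem add (hM : Intertwines φ w M x) (hN : Intertwines φ w N y) :
    Intertwines φ w (M + N) (x + y) := fun j => by
  simp only [Matrix.add_apply, map_add, mul_add, Finset.sum_add_distrib, hM j, hN j, add_mul]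

theorem neg (hM : Intertwines φ w M x) : Intertwines φ w (-M) (-x) := fun j => by
  simp only [Matrix.neg_apply, map_neg, mul_neg, Finset.sum_neg_distrib, hM j, neg_mul]

theorem sub (hM : Intertwines φ w M x) (hN : Intertwines φ w N y) :
    Intertwines φ w (M - N) (x - y) := by
  simpa only [sub_eq_add_neg] using hM.add hN.neg

theorem mul (hM : Intertwines φ w M x) (hN : Intertwines φ w N y) :
    Intertwines φ w (M * N) (x * y) := fun j => by
  simp only [Matrix.mul_apply, map_sum, map_mul, Finset.mul_sum, ← mul_assoc]
  rw [Finset.sum_comm]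
  simp only [← Finset.sum_mul, hM _]
  simp only [mul_assoc, ← Finset.mul_sum, hN j]

theorem smul_one [DecidableEq ι] {r : R} (hr : ∀ t, Commute (φ r) t) :
    Intertwines φ w (r • 1) (φ r) := fun j => by
  rw [Finset.sum_eq_single j] <;> simp +contextual [(hr _).eq]

theorem blockOf {φ : R →+* T} {w : Fin 6 → T} {X Y : Matrix (Fin 6) (Fin 6) R} {x y d : T} {q : R}
    (hX : Intertwines φ w X x) (hY : Intertwines φ w Y y) (hq : ∀ t, Commute (φ q) t)
    (hxd : x * d = φ q - d * y - y * x) :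
    Intertwines φ (Sum.elim w fun i => d * w i) (blockOf q X Y) x := by
  rintro (j | j)
  · simpa [_root_.blockOf] using hX j
  · have h := ((smul_one hq).sub (hY.mul hX)) j
    simp only [_root_.blockOf, Fintype.sum_sum_type, Sum.elim_inl, Sum.elim_inr,
      Matrix.fromBlocks_apply₁₂, Matrix.fromBlocks_apply₂₂, h, mul_assoc, ← Finset.mul_sum,
      hY.neg j]
    rw [← mul_assoc x, hxd]
    noncomm_ring

theorem blockD {φ : R →+* T} {w : Fin 6 → T} {d : T} {p : R} (hp : ∀ t, Commute (φ p) t)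
    (hd : d * d = φ p) : Intertwines φ (Sum.elim w fun i => d * w i) (blockD p) d := by
  rintro (j | j)
  · simp [_root_.blockD, Matrix.one_apply]
  · simpa [_root_.blockD, ← mul_assoc, hd] using smul_one (w := w) hp j

theorem freeAlgebra {K X : Type*} [CommRing K] [Algebra K R] [Algebra K T] [DecidableEq ι]
    {ψ : R →ₐ[K] T} (Φ : FreeAlgebra K X →ₐ[K] Matrix ι ι R) (π : FreeAlgebra K X →ₐ[K] T)
    (h : ∀ k, Intertwines (ψ : R →+* T) w (Φ (FreeAlgebra.ι K k)) (π (FreeAlgebra.ι K k)))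
    (z : FreeAlgebra K X) : Intertwines (ψ : R →+* T) w (Φ z) (π z) := by
  induction z with
  | grade0 r =>
    have hr : ψ (algebraMap K R r) = algebraMap K T r := ψ.commutes r
    have := smul_one (φ := (ψ : R →+* T)) (w := w) (r := algebraMap K R r) fun t => by
      simpa using Algebra.commute_algebraMap_left r t
    simpa [Algebra.algebraMap_eq_smul_one] using this
  | grade1 k => exact h k
  | mul a b ha hb => simpa only [map_mul] using ha.mul hb
  | add a b ha hb => simpa only [map_add] using ha.add hb

end Intertwines

end Intertwining

section NormalWords

variable {K R T : Type*} [CommRing K] [CommRing R] [Ring T] [Algebra K T] {α1 α2 : K}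
  {p q S : R} {φ : R →+* T} {a b c : T}

/-- The words forming the basis of the subalgebra of `𝒯(α₁, α₂)` generated by `a`, `b`, `c` over
the polynomials in `a + b + c`. -/
def normalWord (a b : T) : Fin 6 → T := ![1, a, b, a * b, b * a, a * (b * a)]

theorem mul_mul_cancel_of_sq (ha : a * a = α1 • 1) (x : T) : a * (a * x) = α1 • x := by
  rw [← mul_assoc, ha, smul_mul_assoc, one_mul]

theorem mul_mul_self_eq (ha : a * a = α1 • 1) (hb : b * b = α1 • 1)
    (h : c * a + b * c + a * b = α2 • 1) :
    b * (a * b) = a * (b * a) + α2 • b - α2 • a := by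
  have h1 : b * (c * a + b * c + a * b) = α2 • b := by simp [h]
  have h2 : (c * a + b * c + a * b) * a = α2 • a := by simp [h]
  rw [← h1, ← h2]
  simp only [mul_add, add_mul, mul_assoc, ha, mul_mul_cancel_of_sq hb, mul_smul_comm, mul_one]
  abel

theorem mul_mul_mul_eq (ha : a * a = α1 • 1) (hb : b * b = α1 • 1)
    (h : c * a + b * c + a * b = α2 • 1) (x : T) :
    b * (a * (b * x)) = a * (b * (a * x)) + α2 • (b * x) - α2 • (a * x) := by
  simpa only [sub_mul, add_mul, smul_mul_assoc, mul_assoc] using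
    congrArg (· * x) (mul_mul_self_eq ha hb h)

theorem intertwines_leftA (ha : a * a = α1 • 1) (hp : φ p = α1 • 1) :
    Intertwines φ (normalWord a b) (leftA p) a := by
  intro j
  fin_cases j <;>
    simp [normalWord, leftA, Fin.sum_univ_six, hp, ha, mul_mul_cancel_of_sq ha]

theorem intertwines_leftB (ha : a * a = α1 • 1) (hb : b * b = α1 • 1)
    (h : c * a + b * c + a * b = α2 • 1) (hp : φ p = α1 • 1) (hq : φ q = α2 • 1) :
    Intertwines φ (normalWord a b) (leftB p q) b := by
  intro j
  fin_cases j <;>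
    simp [normalWord, leftB, Fin.sum_univ_six, hp, hq, ha, hb, mul_mul_cancel_of_sq hb,
      mul_mul_self_eq ha hb h, mul_mul_mul_eq ha hb h] <;> module

theorem intertwines_leftC (ha : a * a = α1 • 1) (hb : b * b = α1 • 1) (hc : c * c = α1 • 1)
    (h : c * a + b * c + a * b = α2 • 1) (hp : φ p = α1 • 1) (hq : φ q = α2 • 1)
    (hS : φ S = a + b + c) :
    Intertwines φ (normalWord a b) (leftC p q S) c := by
  have hca : c * a = α2 • 1 - b * c - a * b := by rw [← h]; abel
  have hcax (x : T) : c * (a * x) = α2 • x - b * (c * x) - a * (b * x) := by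
    rw [← mul_assoc, hca]
    simp only [sub_mul, smul_mul_assoc, one_mul, mul_assoc]
  have hcbc : c * (b * c) = b * (c * b) + α2 • c - α2 • b := by
    have h1 : c * (c * a + b * c + a * b) = α2 • c := by simp [h]
    have h2 : (c * a + b * c + a * b) * b = α2 • b := by simp [h]
    rw [← h1, ← h2]
    simp only [mul_add, add_mul, mul_assoc, hb, mul_mul_cancel_of_sq hc, mul_smul_comm, mul_one]
    abel
  have hnum (n : ℕ) [n.AtLeastTwo] : φ ofNat(n) = (ofNat(n) : K) • 1 := by
    rw [map_ofNat, ← Algebra.algebraMap_eq_smul_one, map_ofNat]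
  intro j
  fin_cases j <;>
    simp [normalWord, leftC, Fin.sum_univ_six, hp, hq, hS, pow_succ, mul_add, add_mul, mul_sub,
      mul_assoc, ha, hb, hc, mul_mul_cancel_of_sq ha, mul_mul_cancel_of_sq hb,
      mul_mul_cancel_of_sq hc, mul_mul_self_eq ha hb h, mul_mul_mul_eq ha hb h, hca, hcax, hcbc,
      hnum] <;> module

end NormalWords

section Representation

variable (K : Type) [Field K]

/-- The generic coefficients: polynomials in `S` over polynomials in the parameters `p`, `q`. -/
abbrev ParamRing : Type := Polynomial (MvPolynomial (Fin 2) K)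

namespace ParamRing

/-- The generic value of `α₁`. -/
def p : ParamRing K := Polynomial.C (MvPolynomial.X 0)

/-- The generic value of `α₂`. -/
def q : ParamRing K := Polynomial.C (MvPolynomial.X 1)

/-- The generic value of `a + b + c`. -/
def S : ParamRing K := Polynomial.X

theorem twistNorm_ne_zero : twistNorm (p K) (q K) (S K) ≠ 0 := by
  intro h
  have h' := congrArg
    ((MvPolynomial.eval ![(0 : K), 1]).comp (Polynomial.evalRingHom (0 : MvPolynomial (Fin 2) K))) h
  rw [map_twistNorm] at h'
  simp [twistNorm, p, q, S] at h'

variable {K} {T : Type*} [Ring T] [Algebra K T]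

/-- The specialization of the generic coefficients to given values. -/
def specialize (α1 α2 : K) (s : T) : ParamRing K →ₐ[K] T :=
  Polynomial.eval₂AlgHom ((Algebra.ofId K T).comp (MvPolynomial.aeval ![α1, α2])) s
    fun r => Algebra.commute_algebraMap_left (MvPolynomial.aeval ![α1, α2] r) s

theorem specialize_p (α1 α2 : K) (s : T) : specialize α1 α2 s (p K) = algebraMap K T α1 :=
  (Polynomial.eval₂_C _ _).trans (by simp [Algebra.ofId_apply])

theorem specialize_q (α1 α2 : K) (s : T) : specialize α1 α2 s (q K) = algebraMap K T α2 :=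
  (Polynomial.eval₂_C _ _).trans (by simp [Algebra.ofId_apply])

theorem specialize_S (α1 α2 : K) (s : T) : specialize α1 α2 s (S K) = s :=
  Polynomial.eval₂_X _ _

end ParamRing

open ParamRing

/-- The matrices by which the generators act on the generic algebra `𝒯(p, q)`. -/
def genericRep : FreeAlgebra K (Fin 4) →ₐ[K] Matrix (Fin 6 ⊕ Fin 6) (Fin 6 ⊕ Fin 6) (ParamRing K) :=
  FreeAlgebra.lift K ![blockOf (q K) (leftA (p K)) (leftB (p K) (q K)),
    blockOf (q K) (leftB (p K) (q K)) (leftC (p K) (q K) (S K)),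
    blockOf (q K) (leftC (p K) (q K) (S K)) (leftA (p K)), blockD (p K)]

theorem commute_genericRep (z : FreeAlgebra K (Fin 4)) :
    Commute (genericRep K z) (twist (p K) (q K) (S K)) := by
  induction z with
  | grade0 r =>
    rw [AlgHom.commutes]
    exact Algebra.commute_algebraMap_left r _
  | grade1 k =>
    rw [genericRep, FreeAlgebra.lift_ι_apply]
    fin_cases k
    exacts [commute_blockOf_leftA _ _ _, commute_blockOf_leftB _ _ _, commute_blockOf_leftC _ _ _,
      commute_blockD_twist _ _ _]
  | mul a b ha hb => simpa only [map_mul] using ha.mul_left hb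
  | add a b ha hb => simpa only [map_add] using ha.add_left hb

variable {K} in
theorem mkAlgHom_eq_zero_of_genericRep (α1 α2 α3 : K) {z : FreeAlgebra K (Fin 4)}
    (hz : genericRep K z = 0) : RingQuot.mkAlgHom K (TRel3 K α1 α2 α3) z = 0 := by
  set π := RingQuot.mkAlgHom K (TRel3 K α1 α2 α3) with hπ
  have hrel {x y} (h : TRel K α1 α2 x y) : π x = π y :=
    RingQuot.mkAlgHom_rel K (TRel3.base h)
  obtain ⟨a, ha⟩ : ∃ a, a = π (ι K 0) := ⟨_, rfl⟩
  obtain ⟨b, hb⟩ : ∃ b, b = π (ι K 1) := ⟨_, rfl⟩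
  obtain ⟨c, hc⟩ : ∃ c, c = π (ι K 2) := ⟨_, rfl⟩
  obtain ⟨d, hd⟩ : ∃ d, d = π (ι K 3) := ⟨_, rfl⟩
  have hra := hrel TRel.ra
  have hrb := hrel TRel.rb
  have hrc := hrel TRel.rc
  have hrd := hrel TRel.rd
  have hr1 := hrel TRel.r1
  have hr2 := hrel TRel.r2
  have hr3 := hrel TRel.r3
  have hr4 := hrel TRel.r4
  simp only [map_mul, map_add, map_smul, map_one, ← ha, ← hb, ← hc, ← hd,
    Algebra.algebraMap_eq_smul_one] at hra hrb hrc hrd hr1 hr2 hr3 hr4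
  set ψ := specialize α1 α2 (a + b + c) with hψ
  have hp : ψ (p K) = α1 • 1 := by rw [hψ, specialize_p, Algebra.algebraMap_eq_smul_one]
  have hq : ψ (q K) = α2 • 1 := by rw [hψ, specialize_q, Algebra.algebraMap_eq_smul_one]
  have hS : ψ (S K) = a + b + c := specialize_S _ _ _
  have hpc (t : TAlg3 K α1 α2 α3) : Commute (ψ (p K)) t := by
    rw [hψ, specialize_p]
    exact Algebra.commute_algebraMap_left _ _
  have hqc (t : TAlg3 K α1 α2 α3) : Commute (ψ (q K)) t := by
    rw [hψ, specialize_q]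
    exact Algebra.commute_algebraMap_left _ _
  have hA : Intertwines (ψ : ParamRing K →+* _) (normalWord a b) _ a := intertwines_leftA hra hp
  have hB : Intertwines (ψ : ParamRing K →+* _) (normalWord a b) _ b :=
    intertwines_leftB hra hrb hr1 hp hq
  have hC : Intertwines (ψ : ParamRing K →+* _) (normalWord a b) _ c :=
    intertwines_leftC hra hrb hrc hr1 hp hq hS
  have hgen (k : Fin 4) : Intertwines (ψ : ParamRing K →+* _)
      (Sum.elim (normalWord a b) fun i => d * normalWord a b i) (genericRep K (ι K k))
      (π (ι K k)) := by
    rw [genericRep, FreeAlgebra.lift_ι_apply]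
    fin_cases k
    · exact ha ▸ hA.blockOf hB hqc (by rw [RingHom.coe_coe, hq, ← hr3]; abel)
    · exact hb ▸ hB.blockOf hC hqc (by rw [RingHom.coe_coe, hq, ← hr4]; abel)
    · exact hc ▸ hC.blockOf hA hqc (by rw [RingHom.coe_coe, hq, ← hr2]; abel)
    · exact hd ▸ Intertwines.blockD hpc (by rw [RingHom.coe_coe, hp, hrd])
  simpa [hz, normalWord] using (Intertwines.freeAlgebra (genericRep K) π hgen z (Sum.inl 0)).symm

end Representation

theorem TAlg3_polynomial_identities (K : Type) [Field K] [IsAlgClosed K]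
    (h2 : ringChar K ≠ 2) (h3 : ringChar K ≠ 3) (α1 α2 α3 : K)
    (n : ℕ) (p : FreeAlgebra K (Fin n))
    (hp : ∀ f : FreeAlgebra K (Fin n) →ₐ[K]
        (Matrix (Fin 6) (Fin 6) K × Matrix (Fin 6) (Fin 6) K),
      f p = 0) :
    ∀ g : FreeAlgebra K (Fin n) →ₐ[K] TAlg3 K α1 α2 α3, g p = 0 := by
  intro g
  have hp' (f : FreeAlgebra K (Fin n) →ₐ[K] Matrix (Fin 6) (Fin 6) K) : f p = 0 :=
    congrArg Prod.fst (hp (f.prod f))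
  choose x hx using fun k => RingQuot.mkAlgHom_surjective K (TRel3 K α1 α2 α3) (g (ι K k))
  have hg : g = (RingQuot.mkAlgHom K (TRel3 K α1 α2 α3)).comp (FreeAlgebra.lift K x) := by
    ext k
    simp [hx]
  rw [hg, AlgHom.comp_apply]
  exact mkAlgHom_eq_zero_of_genericRep α1 α2 α3 <|
    identity_of_commute_twist hp' (ParamRing.twistNorm_ne_zero K)
      ((genericRep K).comp (FreeAlgebra.lift K x)) fun z => commute_genericRep K _
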